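/- Let C be an HF-category, D an E-category, and F : C → D an E-functor, with transports S(p, q)(f) := F(Hom_C(r(b), q)(id_b)) ∘ f ∘ F(Hom_C(p, r(a))(id_a)) on the hom-setoids Hom_D(F a, F b). Then for proofs p : a ≈ a', q : b ≈ b' in the object setoid of C and f ∈ Hom_C(a, b): S(p, q)(F(f)) ≈ F(Hom_C(p, q)(f)). (This is the coherence condition making F, as the identity on objects, a functor from C to the full-image HF-category.) -/

import Mathlib

/-- A hom-family presented category (HF-category): a setoid of objects, a
proof-irrelevant family of hom-setoids with transports, identities and an
extensional composition, together with coherence conditions for the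
transports. -/
structure HFCat where
  Ob : Type
  eqv : Ob → Ob → Prop
  eqvE : Equivalence eqv
  Hom : Ob → Ob → Type
  hrel : ∀ a b, Hom a b → Hom a b → Prop
  hrelE : ∀ a b, Equivalence (hrel a b)
  /-- transport `Hom(p, q) : Hom(a, b) → Hom(a', b')` -/
  tr : ∀ {a a' b b'}, eqv a a' → eqv b b' → Hom a b → Hom a' b'
  tr_ext : ∀ {a a' b b'} (p : eqv a a') (q : eqv b b') {f f' : Hom a b},
    hrel a b f f' → hrel a' b' (tr p q f) (tr p q f')
  /-- (F1) transport along reflexivity is the identity -/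
  tr_refl : ∀ {a b} (f : Hom a b), hrel a b (tr (eqvE.refl a) (eqvE.refl b) f) f
  /-- (F2) proof irrelevance of transport -/
  tr_irrel : ∀ {a a' b b'} (p p' : eqv a a') (q q' : eqv b b') (f : Hom a b),
    hrel a' b' (tr p q f) (tr p' q' f)
  /-- (F3) transports compose -/
  tr_trans : ∀ {a a' a'' b b' b''} (p : eqv a a') (p' : eqv a' a'')
    (q : eqv b b') (q' : eqv b' b'') (f : Hom a b),
    hrel a'' b'' (tr p' q' (tr p q f)) (tr (eqvE.trans p p') (eqvE.trans q q') f)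
  id : ∀ a, Hom a a
  comp : ∀ {a b c}, Hom b c → Hom a b → Hom a c
  comp_ext : ∀ {a b c} {g g' : Hom b c} {f f' : Hom a b},
    hrel b c g g' → hrel a b f f' → hrel a c (comp g f) (comp g' f')
  id_left : ∀ {a b} (f : Hom a b), hrel a b (comp (id b) f) f
  id_right : ∀ {a b} (f : Hom a b), hrel a b (comp f (id a)) f
  assoc : ∀ {a b c d} (f : Hom a b) (g : Hom b c) (h : Hom c d),
    hrel a d (comp h (comp g f)) (comp (comp h g) f)
  /-- coherence of identities with transport -/
  coh_id : ∀ {a a'} (p : eqv a a'), hrel a' a' (id a') (tr p p (id a))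
  /-- coherence of composition with transport -/
  coh_comp : ∀ {a a' b b' c c'} (p : eqv a a') (q : eqv b b') (r : eqv c c')
    (f : Hom a b) (g : Hom b c),
    hrel a' c' (comp (tr q r g) (tr p q f)) (tr p r (comp g f))

/-- An E-category: a type of objects, hom-setoids, identities and an
extensional composition satisfying unit and associativity laws. -/
structure ECat where
  Ob : Type
  Hom : Ob → Ob → Type
  hrel : ∀ a b, Hom a b → Hom a b → Prop
  hrelE : ∀ a b, Equivalence (hrel a b)
  id : ∀ a, Hom a a
  comp : ∀ {a b c}, Hom b c → Hom a b → Hom a c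
  comp_ext : ∀ {a b c} {g g' : Hom b c} {f f' : Hom a b},
    hrel b c g g' → hrel a b f f' → hrel a c (comp g f) (comp g' f')
  id_left : ∀ {a b} (f : Hom a b), hrel a b (comp (id b) f) f
  id_right : ∀ {a b} (f : Hom a b), hrel a b (comp f (id a)) f
  assoc : ∀ {a b c d} (f : Hom a b) (g : Hom b c) (h : Hom c d),
    hrel a d (comp h (comp g f)) (comp (comp h g) f)

/-- An E-functor from an HF-category `C` to an E-category `D`. -/
structure EFunctor (C : HFCat) (D : ECat) where
  obj : C.Ob → D.Ob
  map : ∀ {a b}, C.Hom a b → D.Hom (obj a) (obj b)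
  map_ext : ∀ {a b} {f f' : C.Hom a b}, C.hrel a b f f' →
    D.hrel (obj a) (obj b) (map f) (map f')
  map_id : ∀ a, D.hrel (obj a) (obj a) (map (C.id a)) (D.id (obj a))
  map_comp : ∀ {a b c} (g : C.Hom b c) (f : C.Hom a b),
    D.hrel (obj a) (obj c) (map (C.comp g f)) (D.comp (map g) (map f))

/-- The induced transport `S(p, q)` on the hom-setoids `Hom_D(F a, F b)` of the
full image: `S(p, q)(f) = F(Hom_C(r(b), q)(id_b)) ∘ f ∘ F(Hom_C(p, r(a))(id_a))`. -/
def Str {C : HFCat} {D : ECat} (F : EFunctor C D) {a a' b b' : C.Ob}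
    (p : C.eqv a a') (q : C.eqv b b') (f : D.Hom (F.obj a) (F.obj b)) :
    D.Hom (F.obj a') (F.obj b') :=
  D.comp (F.map (C.tr (C.eqvE.refl b) q (C.id b)))
    (D.comp f (F.map (C.tr p (C.eqvE.refl a) (C.id a))))

/-- Composing with a transported identity on the right transports the source. -/
theorem HFCat.comp_tr_id (C : HFCat) {a a' b : C.Ob} (p : C.eqv a a') (f : C.Hom a b) :
    C.hrel a' b (C.comp f (C.tr p (C.eqvE.refl a) (C.id a))) (C.tr p (C.eqvE.refl b) f) :=
  (C.hrelE _ _).trans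
    (C.comp_ext ((C.hrelE _ _).symm (C.tr_refl f)) ((C.hrelE _ _).refl _))
    ((C.hrelE _ _).trans (C.coh_comp p (C.eqvE.refl a) (C.eqvE.refl b) (C.id a) f)
      (C.tr_ext _ _ (C.id_right f)))

/-- Composing with a transported identity on the left transports the target. -/
theorem HFCat.tr_id_comp_tr (C : HFCat) {a a' b b' : C.Ob} (p : C.eqv a a') (q : C.eqv b b')
    (f : C.Hom a b) :
    C.hrel a' b' (C.comp (C.tr (C.eqvE.refl b) q (C.id b)) (C.tr p (C.eqvE.refl b) f))
      (C.tr p q f) :=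
  (C.hrelE _ _).trans (C.coh_comp p (C.eqvE.refl b) q f (C.id b)) (C.tr_ext _ _ (C.id_left f))

/-- Coherence of the induced functor `G` into the full image:
`S(p, q)(F(f)) ≈ F(Hom_C(p, q)(f))`. -/
theorem fullImage_functor_coherence (C : HFCat) (D : ECat) (F : EFunctor C D)
    {a a' b b' : C.Ob} (p : C.eqv a a') (q : C.eqv b b') (f : C.Hom a b) :
    D.hrel (F.obj a') (F.obj b') (Str F p q (F.map f)) (F.map (C.tr p q f)) := by
  have source := (D.hrelE _ _).trans
    ((D.hrelE _ _).symm (F.map_comp f (C.tr p (C.eqvE.refl a) (C.id a))))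
    (F.map_ext (C.comp_tr_id p f))
  have target := (D.hrelE _ _).trans
    ((D.hrelE _ _).symm
      (F.map_comp (C.tr (C.eqvE.refl b) q (C.id b)) (C.tr p (C.eqvE.refl b) f)))
    (F.map_ext (C.tr_id_comp_tr p q f))
  exact (D.hrelE _ _).trans (D.comp_ext ((D.hrelE _ _).refl _) source) target
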